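/- Let ρ be a density matrix on ℂ^d ⊗ ℂ^d with d = p^n a prime power. Then the trace distance to the product of its marginals satisfies Tr|ρ_{AB} − ρ_A ⊗ ρ_B| ≤ (d+1)² √(2 ln 2 · I_c(ρ)), where I_c(ρ) is the maximal classical mutual information obtainable by local measurements. -/

import Mathlib

open scoped BigOperators Classical ComplexOrder
open Matrix Kronecker

noncomputable section

/-- Shannon entropy (base 2) of a finitely supported nonnegative function. -/
def H2 {α : Type} [Fintype α] (p : α → ℝ) : ℝ := ∑ x, -(p x * Real.logb 2 (p x))

/-- Marginal on the first factor. -/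
def margA {α β : Type} [Fintype α] [Fintype β] (p : α × β → ℝ) : α → ℝ :=
  fun a => ∑ b, p (a, b)

/-- Marginal on the second factor. -/
def margB {α β : Type} [Fintype α] [Fintype β] (p : α × β → ℝ) : β → ℝ :=
  fun b => ∑ a, p (a, b)

/-- Classical mutual information (base 2) of a joint distribution. -/
def mi {α β : Type} [Fintype α] [Fintype β] (p : α × β → ℝ) : ℝ :=
  H2 (margA p) + H2 (margB p) - H2 p

/-- Kullback–Leibler divergence in bits. -/
def klDiv {α : Type} [Fintype α] (ν μ : α → ℝ) : ℝ :=
  ∑ x, ν x * Real.logb 2 (ν x / μ x)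

/-- ℓ₁ distance between two functions. -/
def l1 {α : Type} [Fintype α] (ν μ : α → ℝ) : ℝ := ∑ x, |ν x - μ x|

/-- `p` is a probability distribution. -/
def IsProb {α : Type} [Fintype α] (p : α → ℝ) : Prop :=
  (∀ x, 0 ≤ p x) ∧ ∑ x, p x = 1

/-- Probability of an event. -/
def prE {Ω : Type} [Fintype Ω] (p : Ω → ℝ) (E : Ω → Prop) : ℝ :=
  ∑ ω, if E ω then p ω else 0

/-- Conditional distribution given an event. -/
def condP {Ω : Type} [Fintype Ω] (p : Ω → ℝ) (E : Ω → Prop) : Ω → ℝ :=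
  fun ω => if E ω then p ω / prE p E else 0

/-- Distribution of a random variable. -/
def distOf {Ω α : Type} [Fintype Ω] (p : Ω → ℝ) (X : Ω → α) : α → ℝ :=
  fun x => prE p (fun ω => X ω = x)

/-- Joint distribution of a pair of random variables. -/
def jointOf {Ω α β : Type} [Fintype Ω] (p : Ω → ℝ) (X : Ω → α) (Y : Ω → β)
    [Fintype α] [Fintype β] : α × β → ℝ :=
  fun xy => prE p (fun ω => X ω = xy.1 ∧ Y ω = xy.2)

/-- Mutual information between two random variables on a finite probability space. -/
def miRV {Ω α β : Type} [Fintype Ω] [Fintype α] [Fintype β]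
    (p : Ω → ℝ) (X : Ω → α) (Y : Ω → β) : ℝ :=
  mi (jointOf p X Y)



/-- A density matrix: positive semidefinite with unit trace. -/
def IsDensity {n : Type} [Fintype n] [DecidableEq n] (ρ : Matrix n n ℂ) : Prop :=
  ρ.PosSemidef ∧ ρ.trace = 1

/-- A POVM: positive semidefinite elements summing to the identity. -/
def IsPOVM {n ι : Type} [Fintype n] [DecidableEq n] [Fintype ι]
    (M : ι → Matrix n n ℂ) : Prop :=
  (∀ i, (M i).PosSemidef) ∧ ∑ i, M i = 1

/-- Partial trace over the second (Bob) factor: Alice's reduced state. -/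
def trOutB {A B : Type} [Fintype A] [Fintype B]
    (ρ : Matrix (A × B) (A × B) ℂ) : Matrix A A ℂ :=
  Matrix.of fun a a' => ∑ b, ρ (a, b) (a', b)

/-- Partial trace over the first (Alice) factor: Bob's reduced state. -/
def trOutA {A B : Type} [Fintype A] [Fintype B]
    (ρ : Matrix (A × B) (A × B) ℂ) : Matrix B B ℂ :=
  Matrix.of fun b b' => ∑ a, ρ (a, b) (a, b')

/-- von Neumann entropy in bits (via the eigenvalues of a Hermitian matrix). -/
def vN {n : Type} [Fintype n] [DecidableEq n] (ρ : Matrix n n ℂ) : ℝ :=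
  if h : ρ.IsHermitian then ∑ i, -(h.eigenvalues i * Real.logb 2 (h.eigenvalues i)) else 0

/-- Quantum mutual information `S(ρ_A) + S(ρ_B) − S(ρ_AB)` in bits. -/
def Iq {A B : Type} [Fintype A] [DecidableEq A] [Fintype B] [DecidableEq B]
    (ρ : Matrix (A × B) (A × B) ℂ) : ℝ :=
  vN (trOutB ρ) + vN (trOutA ρ) - vN ρ

/-- Trace norm (sum of singular values). -/
def traceNorm {n : Type} [Fintype n] [DecidableEq n] (M : Matrix n n ℂ) : ℝ :=
  ∑ i, Real.sqrt ((Matrix.posSemidef_conjTranspose_mul_self M).1.eigenvalues i)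

/-- Outcome distribution of a local measurement `M_A ⊗ M_B` on a bipartite state. -/
def outcomeProb {A B J K : Type} [Fintype A] [Fintype B] [Fintype J] [Fintype K]
    (ρ : Matrix (A × B) (A × B) ℂ)
    (MA : J → Matrix A A ℂ) (MB : K → Matrix B B ℂ) : J × K → ℝ :=
  fun jk => ((MA jk.1 ⊗ₖ MB jk.2) * ρ).trace.re

/-- The set of classical mutual informations achievable by local POVMs. -/
def IcSet {A B : Type} [Fintype A] [DecidableEq A] [Fintype B] [DecidableEq B]
    (ρ : Matrix (A × B) (A × B) ℂ) : Set ℝ :=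
  {r | ∃ (J K : Type) (_ : Fintype J) (_ : Fintype K)
        (MA : J → Matrix A A ℂ) (MB : K → Matrix B B ℂ),
        IsPOVM MA ∧ IsPOVM MB ∧ r = mi (outcomeProb ρ MA MB)}

/-- Maximal classical mutual information obtainable by local measurements. -/
def Ic {A B : Type} [Fintype A] [DecidableEq A] [Fintype B] [DecidableEq B]
    (ρ : Matrix (A × B) (A × B) ℂ) : ℝ :=
  sSup (IcSet ρ)

/-- Rank-one projector (outer product) `|v⟩⟨v|`. -/
def outer {n : Type} [Fintype n] (v : n → ℂ) : Matrix n n ℂ :=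
  Matrix.of fun i i' => v i * star (v i')

/-- The expectation `⟨φ|M|φ⟩` (real part). -/
def qexp {n : Type} [Fintype n] (φ : n → ℂ) (M : Matrix n n ℂ) : ℝ :=
  (∑ i, ∑ i', star (φ i) * M i i' * φ i').re

/-- The set of mutual informations between the ensemble label and the outcome of a POVM. -/
def IaccSet {n I : Type} [Fintype n] [DecidableEq n] [Fintype I]
    (p : I → ℝ) (η : I → Matrix n n ℂ) : Set ℝ :=
  {r | ∃ (J : Type) (_ : Fintype J) (M : J → Matrix n n ℂ), IsPOVM M ∧
        r = mi (fun ij : I × J => p ij.1 * ((M ij.2) * (η ij.1)).trace.re)}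

/-- Accessible information of an ensemble. -/
def Iacc {n I : Type} [Fintype n] [DecidableEq n] [Fintype I]
    (p : I → ℝ) (η : I → Matrix n n ℂ) : ℝ :=
  sSup (IaccSet p η)

/-- Matrix logarithm (base 2) of a Hermitian matrix, via spectral decomposition. -/
def matLog {n : Type} [Fintype n] [DecidableEq n] (M : Matrix n n ℂ) : Matrix n n ℂ :=
  if h : M.IsHermitian then
    (h.eigenvectorUnitary : Matrix n n ℂ) *
      Matrix.diagonal (fun i => (Real.logb 2 (h.eigenvalues i) : ℂ)) *
      star (h.eigenvectorUnitary : Matrix n n ℂ)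
  else 0

/-- Quantum relative entropy `Tr ν log₂ ν − Tr ν log₂ μ`. -/
def qRelEnt {n : Type} [Fintype n] [DecidableEq n] (ν μ : Matrix n n ℂ) : ℝ :=
  ((ν * matLog ν).trace - (ν * matLog μ).trace).re

/-- The trace norm of a combination of rank-one projectors onto unit vectors is at most the
`ℓ₁` norm of the coefficients. -/
theorem traceNorm_le_sum_norm {n κ : Type} [Fintype n] [DecidableEq n] [Fintype κ]
    (M : Matrix n n ℂ) (c : κ → ℂ) (φ : κ → EuclideanSpace ℂ n) (hφ : ∀ k, ‖φ k‖ = 1)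
    (hM : ∀ i j, M i j = ∑ k, c k * (φ k i * star (φ k j))) :
    traceNorm M ≤ ∑ k, ‖c k‖ := by
  set hA := (posSemidef_conjTranspose_mul_self M).1
  set v := hA.eigenvectorBasis
  set σ : n → ℝ := fun i => √(hA.eigenvalues i)
  set u : n → EuclideanSpace ℂ n := fun i => WithLp.toLp 2 (M *ᵥ (v i).ofLp)
  have huu : ∀ i j, inner ℂ (u i) (u j) = if i = j then ((σ i : ℂ)) ^ 2 else 0 := by
    intro i j
    have h1 : inner ℂ (u i) (u j) = inner ℂ (v i) (hA.eigenvalues j • v j) := by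
      rw [EuclideanSpace.inner_eq_star_dotProduct, EuclideanSpace.inner_eq_star_dotProduct]
      simp only [u, WithLp.ofLp_smul]
      rw [← hA.mulVec_eigenvectorBasis j, star_mulVec, dotProduct_comm, ← dotProduct_mulVec,
        mulVec_mulVec, dotProduct_comm]
    rw [h1, inner_smul_right_eq_smul, v.inner_eq_ite]
    split_ifs with h
    · subst h
      have : σ i ^ 2 = hA.eigenvalues i :=
        Real.sq_sqrt ((posSemidef_conjTranspose_mul_self M).eigenvalues_nonneg i)
      rw [← Complex.ofReal_pow, this]
      simp
    · simp
  have hu : ∀ i, u i = ∑ k, (c k * inner ℂ (φ k) (v i)) • φ k := by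
    intro i
    ext j
    simp only [u, mulVec, dotProduct, hM, WithLp.ofLp_sum, WithLp.ofLp_smul, Finset.sum_apply,
      Pi.smul_apply, smul_eq_mul, PiLp.inner_apply, RCLike.inner_apply, Finset.sum_mul,
      Finset.mul_sum]
    rw [Finset.sum_comm]
    refine Finset.sum_congr rfl fun k _ => Finset.sum_congr rfl fun l _ => ?_
    simp only [starRingEnd_apply]
    ring
  let e : {i // σ i ≠ 0} → EuclideanSpace ℂ n := fun i => ((σ i : ℂ))⁻¹ • u i
  have he : Orthonormal ℂ e := by
    rw [orthonormal_iff_ite]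
    rintro ⟨i, hi⟩ ⟨j, hj⟩
    have hi' : (σ i : ℂ) ≠ 0 := by exact_mod_cast hi
    simp only [e, inner_smul_left, inner_smul_right, huu, Subtype.mk.injEq]
    split_ifs with h
    · subst h
      simp only [map_inv₀, Complex.conj_ofReal]
      field_simp
    · simp
  have hv : Orthonormal ℂ (fun i : {i // σ i ≠ 0} => v i) :=
    v.orthonormal.comp _ Subtype.val_injective
  have hσ : ∀ i : {i // σ i ≠ 0}, (σ i : ℂ) =
      ∑ k, c k * (inner ℂ (e i) (φ k) * inner ℂ (φ k) (v i)) := by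
    rintro ⟨i, hi⟩
    have hi' : (σ i : ℂ) ≠ 0 := by exact_mod_cast hi
    have h1 : inner ℂ (e ⟨i, hi⟩) (u i) = (σ i : ℂ) := by
      simp only [e, inner_smul_left, huu, map_inv₀, Complex.conj_ofReal, if_true]
      field_simp
    rw [← h1]
    conv_lhs => rw [hu i, inner_sum]
    refine Finset.sum_congr rfl fun k _ => ?_
    rw [inner_smul_right]
    ring
  have hbound : ∀ k, ∑ i : {i // σ i ≠ 0}, ‖inner ℂ (e i) (φ k)‖ * ‖inner ℂ (φ k) (v i)‖ ≤ 1 := by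
    intro k
    have h1 := he.sum_inner_products_le (x := φ k) (s := Finset.univ)
    have h2 := hv.sum_inner_products_le (x := φ k) (s := Finset.univ)
    rw [hφ, one_pow] at h1 h2
    calc ∑ i : {i // σ i ≠ 0}, ‖inner ℂ (e i) (φ k)‖ * ‖inner ℂ (φ k) (v i)‖
        ≤ ∑ i : {i // σ i ≠ 0},
          (‖inner ℂ (e i) (φ k)‖ ^ 2 + ‖inner ℂ (v i : EuclideanSpace ℂ n) (φ k)‖ ^ 2) / 2 := by
          refine Finset.sum_le_sum fun i _ => ?_
          rw [norm_inner_symm (φ k)]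
          nlinarith [sq_nonneg (‖inner ℂ (e i) (φ k)‖ -
            ‖inner ℂ (v i : EuclideanSpace ℂ n) (φ k)‖)]
      _ ≤ 1 := by
          rw [← Finset.sum_div, Finset.sum_add_distrib]
          linarith
  have hsum : traceNorm M = ∑ i : {i // σ i ≠ 0}, σ i := by
    change ∑ i, σ i = _
    rw [← Finset.sum_filter_ne_zero, ← Finset.sum_subtype_eq_sum_filter]
    simp [Finset.subtype_univ]
  rw [hsum]
  calc ∑ i : {i // σ i ≠ 0}, σ i
      ≤ ∑ i : {i // σ i ≠ 0}, ∑ k,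
        ‖c k‖ * (‖inner ℂ (e i) (φ k)‖ * ‖inner ℂ (φ k) (v i)‖) := by
        refine Finset.sum_le_sum fun i _ => ?_
        have h1 : σ i ≤ ‖(σ i : ℂ)‖ := by
          rw [Complex.norm_real]
          exact le_abs_self _
        refine h1.trans ?_
        rw [hσ i]
        refine (norm_sum_le _ _).trans_eq ?_
        simp only [norm_mul]
    _ = ∑ k, ‖c k‖ * ∑ i : {i // σ i ≠ 0},
        (‖inner ℂ (e i) (φ k)‖ * ‖inner ℂ (φ k) (v i)‖) := by
        rw [Finset.sum_comm]
        simp only [Finset.mul_sum]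
    _ ≤ ∑ k, ‖c k‖ := by
        refine Finset.sum_le_sum fun k _ => ?_
        exact mul_le_of_le_one_right (norm_nonneg _) (hbound k)

/-- Standard basis vectors of `(ℤ/3)ⁿ` form a Sidon set. -/
theorem single_add_single_eq_iff {n : Type} [DecidableEq n] (i j k l : n) :
    (Pi.single i 1 + Pi.single k 1 : n → ZMod 3) = Pi.single j 1 + Pi.single l 1 ↔
      (i = j ∧ k = l) ∨ (i = l ∧ k = j) := by
  have hinj : ∀ a b : n, (Pi.single a 1 : n → ZMod 3) = Pi.single b 1 → a = b := by
    intro a b h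
    by_contra hab
    simpa [Pi.single_apply, hab] using congr_fun h a
  constructor
  · intro h
    by_cases hij : i = j
    · subst hij
      exact Or.inl ⟨rfl, hinj _ _ (add_left_cancel h)⟩
    by_cases hil : i = l
    · subst hil
      rw [add_comm] at h
      exact Or.inr ⟨rfl, hinj _ _ (add_right_cancel h)⟩
    have hi := congr_fun h i
    simp only [Pi.add_apply, Pi.single_apply, hij, hil, if_false, if_true] at hi
    exfalso
    clear h
    split_ifs at hi
    · exact absurd hi (by decide)
    · exact absurd hi (by decide)
  · rintro (⟨rfl, rfl⟩ | ⟨rfl, rfl⟩)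
    · rfl
    · exact add_comm _ _

/-- In every dimension there is a finite weighted complex projective `2`-design: the standard
basis together with the vectors of phases given by the characters of `(ℤ/3)ⁿ`. -/
theorem exists_projective_two_design (n : Type) [Fintype n] [DecidableEq n] [Nonempty n] :
    ∃ (κ : Type) (_ : Fintype κ) (w : κ → ℝ) (φ : κ → n → ℂ),
      (∀ x, 0 ≤ w x) ∧ (∀ x, ∑ i, ‖φ x i‖ ^ 2 = 1) ∧
      ∀ i j k l, ∑ x, (w x : ℂ) * (φ x i * star (φ x j) * (φ x k * star (φ x l))) =
        (if i = j ∧ k = l then 1 else 0) + (if i = l ∧ k = j then 1 else 0) := by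
  let G := n → ZMod 3
  let D : ℝ := Fintype.card n
  have hD : 0 < D := by
    have : 0 < Fintype.card n := Fintype.card_pos
    exact Nat.cast_pos.2 this
  have hG : (Fintype.card G : ℂ) ≠ 0 := Nat.cast_ne_zero.2 Fintype.card_ne_zero
  have hs : ((√D : ℝ) : ℂ) ^ 2 = D := by
    rw [← Complex.ofReal_pow, Real.sq_sqrt hD.le]
  have hs0 : ((√D : ℝ) : ℂ) ≠ 0 := by
    exact_mod_cast (Real.sqrt_pos.2 hD).ne'
  refine ⟨n ⊕ AddChar G ℂ, inferInstance,
    Sum.elim (fun _ => 1) (fun _ => D ^ 2 / Fintype.card G),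
    Sum.elim (fun a i => if i = a then 1 else 0)
      (fun ψ i => ψ (Pi.single i 1) / ((√D : ℝ) : ℂ)), ?_, ?_, ?_⟩
  · rintro (a | ψ)
    · simp
    · simp only [Sum.elim_inr]
      positivity
  · rintro (a | ψ)
    · simp [apply_ite norm, ite_pow]
    · simp only [Sum.elim_inr, norm_div, AddChar.norm_apply, Complex.norm_real, Real.norm_eq_abs,
        div_pow, sq_abs, Real.sq_sqrt hD.le, Finset.sum_const, Finset.card_univ, nsmul_eq_mul]
      change D * _ = 1
      field_simp
  · intro i j k l
    rw [Fintype.sum_sum_type]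
    have h1 : ∑ ψ : AddChar G ℂ, ψ ((Pi.single i 1 + Pi.single k 1) -
        (Pi.single j 1 + Pi.single l 1)) =
        if (i = j ∧ k = l) ∨ (i = l ∧ k = j) then (Fintype.card G : ℂ) else 0 := by
      rw [AddChar.sum_apply_eq_ite]
      simp only [sub_eq_zero]
      exact if_congr (single_add_single_eq_iff i j k l) rfl rfl
    have h2 : ∀ ψ : AddChar G ℂ, ((D ^ 2 / Fintype.card G : ℝ) : ℂ) *
        (ψ (Pi.single i 1) / ((√D : ℝ) : ℂ) * star (ψ (Pi.single j 1) / ((√D : ℝ) : ℂ)) *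
          (ψ (Pi.single k 1) / ((√D : ℝ) : ℂ) * star (ψ (Pi.single l 1) / ((√D : ℝ) : ℂ)))) =
        (Fintype.card G : ℂ)⁻¹ * ψ ((Pi.single i 1 + Pi.single k 1) -
          (Pi.single j 1 + Pi.single l 1)) := by
      intro ψ
      have hc : ∀ g, star (ψ g) = ψ (-g) := fun g => by
        rw [AddChar.map_neg_eq_conj]; rfl
      have hr : star ((√D : ℝ) : ℂ) = ((√D : ℝ) : ℂ) := Complex.conj_ofReal _
      rw [sub_eq_add_neg, neg_add, AddChar.map_add_eq_mul, AddChar.map_add_eq_mul,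
        AddChar.map_add_eq_mul, star_div₀, star_div₀, hc, hc, hr]
      push_cast
      rw [← hs]
      field_simp
    simp only [Sum.elim_inl, Sum.elim_inr, h2]
    have h3 : ∑ a, ((1 : ℝ) : ℂ) * ((if i = a then 1 else 0) * star (if j = a then (1 : ℂ) else 0) *
        ((if k = a then 1 else 0) * star (if l = a then (1 : ℂ) else 0))) =
        if j = i ∧ k = i ∧ l = i then 1 else 0 := by
      rw [Finset.sum_eq_single i]
      · by_cases hj : j = i <;> by_cases hk : k = i <;> by_cases hl : l = i <;> simp [hj, hk, hl]
      · intro b _ hb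
        simp [hb.symm]
      · simp
    have h4 : (j = i ∧ k = i ∧ l = i) ↔ ((i = j ∧ k = l) ∧ (i = l ∧ k = j)) := by
      constructor
      · rintro ⟨rfl, rfl, rfl⟩
        simp
      · rintro ⟨⟨rfl, rfl⟩, rfl, -⟩
        simp
    rw [h3, ← Finset.mul_sum, h1, if_congr h4 rfl rfl]
    by_cases hP : i = j ∧ k = l <;> by_cases hQ : i = l ∧ k = j
    · rw [if_pos ⟨hP, hQ⟩, if_pos (Or.inl hP), if_pos hP, if_pos hQ, inv_mul_cancel₀ hG]
    · rw [if_neg fun h => hQ h.2, if_pos (Or.inl hP), if_pos hP, if_neg hQ, inv_mul_cancel₀ hG]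
      ring
    · rw [if_neg fun h => hP h.1, if_pos (Or.inr hQ), if_neg hP, if_pos hQ, inv_mul_cancel₀ hG]
    · rw [if_neg fun h => hP h.1, if_neg fun h => h.elim hP hQ, if_neg hP, if_neg hQ, mul_zero]

theorem log_lower_bound_of_pos {x : ℝ} (hx : 0 < x) :
    (x - 1) * (5 * x + 1) / (2 * x * (x + 2)) ≤ Real.log x := by
  let g : ℝ → ℝ := fun x => Real.log x - (x - 1) * (5 * x + 1) / (2 * x * (x + 2))
  have hg : ∀ y, 0 < y → HasDerivAt g ((y - 1) ^ 3 / (y ^ 2 * (y + 2) ^ 2)) y := by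
    intro y hy
    have hn : HasDerivAt (fun x : ℝ => (x - 1) * (5 * x + 1)) (1 * (5 * y + 1) + (y - 1) * 5) y := by
      refine ((hasDerivAt_id y).sub_const 1).mul ?_
      simpa using ((hasDerivAt_id y).const_mul 5).add_const 1
    have hd : HasDerivAt (fun x : ℝ => 2 * x * (x + 2)) (2 * (y + 2) + 2 * y * 1) y := by
      refine HasDerivAt.mul ?_ ((hasDerivAt_id y).add_const 2)
      simpa using (hasDerivAt_id y).const_mul 2
    have hd0 : 2 * y * (y + 2) ≠ 0 := by positivity
    refine ((Real.hasDerivAt_log hy.ne').sub (hn.div hd hd0)).congr_deriv ?_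
    field_simp
    ring
  have h1 : g 1 = 0 := by simp [g]
  suffices 0 ≤ g x by
    simp only [g] at this
    linarith
  rw [← h1]
  rcases le_total x 1 with h | h
  · have : AntitoneOn g (Set.Icc x 1) := by
      refine antitoneOn_of_deriv_nonpos (convex_Icc _ _)
        (fun y hy => (hg y (hx.trans_le hy.1)).continuousAt.continuousWithinAt) ?_ ?_
      all_goals
        intro y hy
        rw [interior_Icc] at hy
        have hy0 : 0 < y := hx.trans hy.1
      · exact (hg y hy0).differentiableAt.differentiableWithinAt
      · rw [(hg y hy0).deriv]
        refine div_nonpos_of_nonpos_of_nonneg ?_ (by positivity)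
        exact Odd.pow_nonpos (by decide) (by linarith [hy.2])
    exact this ⟨le_rfl, h⟩ ⟨h, le_rfl⟩ h
  · have : MonotoneOn g (Set.Icc 1 x) := by
      refine monotoneOn_of_deriv_nonneg (convex_Icc _ _)
        (fun y hy => (hg y (one_pos.trans_le hy.1)).continuousAt.continuousWithinAt) ?_ ?_
      all_goals
        intro y hy
        rw [interior_Icc] at hy
        have hy0 : 0 < y := one_pos.trans hy.1
      · exact (hg y hy0).differentiableAt.differentiableWithinAt
      · rw [(hg y hy0).deriv]
        have : 0 ≤ y - 1 := by linarith [hy.1]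
        positivity
    exact this ⟨le_rfl, h⟩ ⟨h, le_rfl⟩ h

theorem sq_sub_le_mul_log {p q : ℝ} (hp : 0 ≤ p) (hq : 0 ≤ q) (hpq : q = 0 → p = 0) :
    (p - q) ^ 2 ≤ (2 / 3 * (p + 2 * q)) * (p * (Real.log p - Real.log q) - p + q) := by
  rcases hq.eq_or_lt with h | hq
  · simp [← h, hpq h.symm]
  rcases hp.eq_or_lt with h | hp
  · rw [← h]
    nlinarith [sq_nonneg q]
  have h := log_lower_bound_of_pos (div_pos hp hq)
  rw [Real.log_div hp.ne' hq.ne'] at h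
  have h2 : p * ((p / q - 1) * (5 * (p / q) + 1) / (2 * (p / q) * (p / q + 2))) =
      (p - q) * (5 * p + q) / (2 * (p + 2 * q)) := by
    field_simp
  have h3 := mul_le_mul_of_nonneg_left h hp.le
  rw [h2] at h3
  have h4 : 0 < 2 / 3 * (p + 2 * q) := by positivity
  calc (p - q) ^ 2 = (2 / 3 * (p + 2 * q)) *
        ((p - q) * (5 * p + q) / (2 * (p + 2 * q)) - p + q) := by
        field_simp
        ring
    _ ≤ _ := by gcongr

/-- **Pinsker's inequality**, in nats, for finitely supported distributions. -/
theorem sq_sum_abs_sub_le {α : Type} [Fintype α] {p q : α → ℝ} (hp : IsProb p) (hq : IsProb q)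
    (hpq : ∀ x, q x = 0 → p x = 0) :
    (∑ x, |p x - q x|) ^ 2 ≤ 2 * ∑ x, p x * (Real.log (p x) - Real.log (q x)) := by
  have hpos : ∀ x, 0 ≤ p x * (Real.log (p x) - Real.log (q x)) - p x + q x := by
    intro x
    have h := sq_sub_le_mul_log (hp.1 x) (hq.1 x) (hpq x)
    have h0 : 0 ≤ 2 / 3 * (p x + 2 * q x) := by linarith [hp.1 x, hq.1 x]
    rcases h0.eq_or_lt with h0 | h0
    · have h1 : p x = 0 := by linarith [hp.1 x, hq.1 x]
      have h2 : q x = 0 := by linarith [hp.1 x, hq.1 x]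
      simp [h1, h2]
    · exact nonneg_of_mul_nonneg_right ((sq_nonneg _).trans h) h0
  refine (Finset.sum_sq_le_sum_mul_sum_of_sq_le_mul Finset.univ (f := fun x => 2 / 3 * (p x + 2 * q x))
    (g := fun x => p x * (Real.log (p x) - Real.log (q x)) - p x + q x)
    (fun x _ => by linarith [hp.1 x, hq.1 x]) (fun x _ => hpos x)
    (fun x _ => by simpa only [sq_abs] using sq_sub_le_mul_log (hp.1 x) (hq.1 x) (hpq x))).trans_eq ?_
  rw [← Finset.mul_sum, Finset.sum_add_distrib, ← Finset.mul_sum, Finset.sum_add_distrib,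
    Finset.sum_sub_distrib, hp.2, hq.2]
  ring

theorem le_margA {α β : Type} [Fintype α] [Fintype β] {p : α × β → ℝ} (hp : ∀ x, 0 ≤ p x)
    (x : α × β) : p x ≤ margA p x.1 :=
  Finset.single_le_sum (f := fun b => p (x.1, b)) (fun _ _ => hp _) (Finset.mem_univ x.2)

theorem le_margB {α β : Type} [Fintype α] [Fintype β] {p : α × β → ℝ} (hp : ∀ x, 0 ≤ p x)
    (x : α × β) : p x ≤ margB p x.2 :=
  Finset.single_le_sum (f := fun a => p (a, x.2)) (fun _ _ => hp _) (Finset.mem_univ x.1)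

/-- Mutual information as the relative entropy to the product of the marginals. -/
theorem log_two_mul_mi {α β : Type} [Fintype α] [Fintype β] {p : α × β → ℝ}
    (hp : ∀ x, 0 ≤ p x) :
    Real.log 2 * mi p =
      ∑ x, p x * (Real.log (p x) - Real.log (margA p x.1 * margB p x.2)) := by
  have hl : Real.log 2 ≠ 0 := (Real.log_pos one_lt_two).ne'
  have hA : ∑ x : α × β, p x * Real.log (margA p x.1) = ∑ a, margA p a * Real.log (margA p a) := by
    rw [Fintype.sum_prod_type]
    simp only [← Finset.sum_mul]
    rfl
  have hB : ∑ x : α × β, p x * Real.log (margB p x.2) = ∑ b, margB p b * Real.log (margB p b) := by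
    rw [Fintype.sum_prod_type_right]
    simp only [← Finset.sum_mul]
    rfl
  have hH : ∀ {γ : Type} [Fintype γ] (f : γ → ℝ),
      Real.log 2 * H2 f = -∑ x, f x * Real.log (f x) := by
    intro γ _ f
    rw [H2, Finset.mul_sum, ← Finset.sum_neg_distrib]
    refine Finset.sum_congr rfl fun x _ => ?_
    rw [Real.logb]
    field_simp
  have hterm : ∀ x, p x * (Real.log (p x) - Real.log (margA p x.1 * margB p x.2)) =
      p x * Real.log (p x) - p x * Real.log (margA p x.1) - p x * Real.log (margB p x.2) := by
    intro x
    rcases (hp x).eq_or_lt with h | h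
    · simp [← h]
    · rw [Real.log_mul (h.trans_le (le_margA hp x)).ne' (h.trans_le (le_margB hp x)).ne']
      ring
  simp only [hterm, Finset.sum_sub_distrib, hA, hB]
  rw [mi, mul_sub, mul_add, hH, hH, hH]
  ring

theorem sum_margA {α β : Type} [Fintype α] [Fintype β] (p : α × β → ℝ) :
    ∑ a, margA p a = ∑ x, p x := (Fintype.sum_prod_type p).symm

theorem sum_margB {α β : Type} [Fintype α] [Fintype β] (p : α × β → ℝ) :
    ∑ b, margB p b = ∑ x, p x := (Fintype.sum_prod_type_right p).symm

/-- Pinsker's inequality for a joint distribution and the product of its marginals. -/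
theorem sum_abs_sub_marg_le {α β : Type} [Fintype α] [Fintype β] {p : α × β → ℝ}
    (hp : IsProb p) :
    ∑ x, |p x - margA p x.1 * margB p x.2| ≤ √(2 * Real.log 2 * mi p) := by
  have hA : ∀ x : α × β, 0 ≤ margA p x.1 := fun x => (hp.1 x).trans (le_margA hp.1 x)
  have hB : ∀ x : α × β, 0 ≤ margB p x.2 := fun x => (hp.1 x).trans (le_margB hp.1 x)
  have hq : IsProb fun x : α × β => margA p x.1 * margB p x.2 := by
    refine ⟨fun x => mul_nonneg (hA x) (hB x), ?_⟩
    rw [Fintype.sum_prod_type]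
    simp only [← Finset.mul_sum, sum_margA, sum_margB, hp.2, mul_one]
  apply Real.le_sqrt_of_sq_le
  rw [mul_assoc, log_two_mul_mi hp.1]
  refine sq_sum_abs_sub_le hp hq fun x hx => ?_
  rcases mul_eq_zero.1 hx with h | h
  · exact le_antisymm ((le_margA hp.1 x).trans_eq h) (hp.1 x)
  · exact le_antisymm ((le_margB hp.1 x).trans_eq h) (hp.1 x)

/-- If `p (a, b) ≤ t b * margA p a`, the mutual information is bounded in terms of `∑ t`. -/
theorem log_two_mul_mi_le {α β : Type} [Fintype α] [Fintype β] {p : α × β → ℝ}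
    (hp : IsProb p) (t : β → ℝ) (ht : ∀ b, 0 ≤ t b) (h : ∀ x, p x ≤ t x.2 * margA p x.1) :
    Real.log 2 * mi p ≤ ∑ b, t b - 1 := by
  rw [log_two_mul_mi hp.1]
  have hterm : ∀ x : α × β, p x * (Real.log (p x) - Real.log (margA p x.1 * margB p x.2)) ≤
      p x * (t x.2 / margB p x.2) - p x := by
    intro x
    rcases (hp.1 x).eq_or_lt with h0 | h0
    · simp [← h0]
    have hA := h0.trans_le (le_margA hp.1 x)
    have hB := h0.trans_le (le_margB hp.1 x)
    have h1 : Real.log (p x) - Real.log (margA p x.1 * margB p x.2) ≤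
        t x.2 / margB p x.2 - 1 := by
      rw [← Real.log_div h0.ne' (by positivity)]
      refine (Real.log_le_sub_one_of_pos (by positivity)).trans ?_
      gcongr ?_ - 1
      rw [div_le_div_iff₀ (by positivity) hB]
      nlinarith [h x]
    nlinarith
  refine (Finset.sum_le_sum fun x _ => hterm x).trans ?_
  rw [Finset.sum_sub_distrib, hp.2, Fintype.sum_prod_type_right]
  gcongr with b
  change ∑ a, p (a, b) * (t b / margB p b) ≤ t b
  rw [← Finset.sum_mul]
  change margB p b * (t b / margB p b) ≤ t b
  rcases eq_or_ne (margB p b) 0 with h0 | h0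
  · simp [h0, ht b]
  · rw [mul_div_cancel₀ _ h0]

theorem trace_mul_nonneg {n : Type} [Fintype n] [DecidableEq n] {M N : Matrix n n ℂ}
    (hM : M.PosSemidef) (hN : N.PosSemidef) : 0 ≤ (M * N).trace := by
  obtain ⟨m, v, rfl⟩ := posSemidef_iff_eq_sum_vecMulVec.1 hN
  rw [Finset.mul_sum, trace_sum]
  refine Finset.sum_nonneg fun i _ => ?_
  rw [mul_vecMulVec, trace_vecMulVec, dotProduct_comm]
  exact hM.dotProduct_mulVec_nonneg (v i)

theorem posSemidef_trace_smul_one_sub {n : Type} [Fintype n] [DecidableEq n] {M : Matrix n n ℂ}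
    (hM : M.PosSemidef) : (M.trace • (1 : Matrix n n ℂ) - M).PosSemidef := by
  set U : Matrix n n ℂ := (hM.1.eigenvectorUnitary : Matrix n n ℂ)
  have hU : U * Uᴴ = 1 := Unitary.mul_star_self_of_mem hM.1.eigenvectorUnitary.2
  have hspec : M = U * diagonal (fun i => (hM.1.eigenvalues i : ℂ)) * Uᴴ := by
    conv_lhs => rw [hM.1.spectral_theorem, Unitary.conjStarAlgAut_apply]
    rfl
  have key : M.trace • (1 : Matrix n n ℂ) - M =
      U * diagonal (fun i => M.trace - (hM.1.eigenvalues i : ℂ)) * Uᴴ := by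
    have hd : diagonal (fun i => M.trace - (hM.1.eigenvalues i : ℂ)) =
        M.trace • (1 : Matrix n n ℂ) - diagonal (fun i => (hM.1.eigenvalues i : ℂ)) := by
      rw [smul_one_eq_diagonal, diagonal_sub]
    rw [hd, mul_sub, sub_mul, ← hspec, Matrix.mul_smul, mul_one, Matrix.smul_mul, hU]
  rw [key]
  refine PosSemidef.mul_mul_conjTranspose_same (PosSemidef.diagonal fun i => ?_) U
  rw [Pi.zero_apply, hM.1.trace_eq_sum_eigenvalues, sub_nonneg]
  exact Finset.single_le_sum (f := fun i => (hM.1.eigenvalues i : ℂ))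
    (fun i _ => by exact_mod_cast hM.eigenvalues_nonneg i) (Finset.mem_univ i)

theorem trace_kronecker_one_mul {A B : Type} [Fintype A] [Fintype B] [DecidableEq B]
    (M : Matrix A A ℂ) (ρ : Matrix (A × B) (A × B) ℂ) :
    ((M ⊗ₖ (1 : Matrix B B ℂ)) * ρ).trace = (M * trOutB ρ).trace := by
  simp only [trace, diag_apply, mul_apply, Fintype.sum_prod_type, kroneckerMap_apply, one_apply,
    trOutB, of_apply, mul_ite, mul_one, mul_zero, ite_mul, zero_mul, Finset.sum_ite_eq,
    Finset.mem_univ, if_true, Finset.mul_sum]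
  exact Finset.sum_congr rfl fun _ _ => Finset.sum_comm

theorem trace_one_kronecker_mul {A B : Type} [Fintype A] [DecidableEq A] [Fintype B]
    (N : Matrix B B ℂ) (ρ : Matrix (A × B) (A × B) ℂ) :
    (((1 : Matrix A A ℂ) ⊗ₖ N) * ρ).trace = (N * trOutA ρ).trace := by
  simp only [trace, diag_apply, mul_apply, Fintype.sum_prod_type_right, kroneckerMap_apply,
    one_apply, trOutA, of_apply, ite_mul, one_mul, zero_mul, Finset.sum_ite_eq,
    Finset.mem_univ, if_true, Finset.mul_sum]
  exact Finset.sum_congr rfl fun _ _ => Finset.sum_comm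

theorem sum_kronecker_left {A B K : Type} [Fintype B] [DecidableEq B] [Fintype K]
    {MB : K → Matrix B B ℂ} (M : Matrix A A ℂ) (hB : IsPOVM MB) :
    ∑ k, M ⊗ₖ MB k = M ⊗ₖ (1 : Matrix B B ℂ) := by
  rw [← hB.2]
  ext a b
  simp [Matrix.sum_apply, Finset.mul_sum]

theorem sum_kronecker_right {A B J : Type} [Fintype A] [DecidableEq A] [Fintype J]
    {MA : J → Matrix A A ℂ} (N : Matrix B B ℂ) (hA : IsPOVM MA) :
    ∑ j, MA j ⊗ₖ N = (1 : Matrix A A ℂ) ⊗ₖ N := by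
  rw [← hA.2]
  ext a b
  simp [Matrix.sum_apply, Finset.sum_mul]

theorem trace_trOutB {A B : Type} [Fintype A] [Fintype B] (ρ : Matrix (A × B) (A × B) ℂ) :
    (trOutB ρ).trace = ρ.trace := by
  simp [trace, trOutB, Fintype.sum_prod_type]

theorem trace_trOutA {A B : Type} [Fintype A] [Fintype B] (ρ : Matrix (A × B) (A × B) ℂ) :
    (trOutA ρ).trace = ρ.trace := by
  simp [trace, trOutA, Fintype.sum_prod_type_right]

theorem trOutB_kronecker {A B : Type} [Fintype A] [Fintype B] (M : Matrix A A ℂ)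
    (N : Matrix B B ℂ) : trOutB (M ⊗ₖ N) = N.trace • M := by
  ext a a'
  simp [trOutB, trace, ← Finset.mul_sum, mul_comm]

theorem trOutA_kronecker {A B : Type} [Fintype A] [Fintype B] (M : Matrix A A ℂ)
    (N : Matrix B B ℂ) : trOutA (M ⊗ₖ N) = M.trace • N := by
  ext b b'
  simp [trOutA, trace, ← Finset.sum_mul]

theorem trOutB_sub {A B : Type} [Fintype A] [Fintype B] (M N : Matrix (A × B) (A × B) ℂ) :
    trOutB (M - N) = trOutB M - trOutB N := by
  ext
  simp [trOutB]

theorem trOutA_sub {A B : Type} [Fintype A] [Fintype B] (M N : Matrix (A × B) (A × B) ℂ) :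
    trOutA (M - N) = trOutA M - trOutA N := by
  ext
  simp [trOutA]

theorem trOutB_sub_kronecker {A B : Type} [Fintype A] [DecidableEq A] [Fintype B] [DecidableEq B]
    {ρ : Matrix (A × B) (A × B) ℂ} (hρ : IsDensity ρ) :
    trOutB (ρ - trOutB ρ ⊗ₖ trOutA ρ) = 0 := by
  rw [trOutB_sub, trOutB_kronecker, trace_trOutA, hρ.2, one_smul, sub_self]

theorem trOutA_sub_kronecker {A B : Type} [Fintype A] [DecidableEq A] [Fintype B] [DecidableEq B]
    {ρ : Matrix (A × B) (A × B) ℂ} (hρ : IsDensity ρ) :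
    trOutA (ρ - trOutB ρ ⊗ₖ trOutA ρ) = 0 := by
  rw [trOutA_sub, trOutA_kronecker, trace_trOutB, hρ.2, one_smul, sub_self]

section LocalMeasurement

variable {A B J K : Type} [Fintype A] [DecidableEq A] [Fintype B] [DecidableEq B]
  [Fintype J] [Fintype K] {ρ : Matrix (A × B) (A × B) ℂ}
  {MA : J → Matrix A A ℂ} {MB : K → Matrix B B ℂ}

theorem ofReal_outcomeProb (hρ : ρ.PosSemidef) (hA : IsPOVM MA) (hB : IsPOVM MB) (x : J × K) :
    (outcomeProb ρ MA MB x : ℂ) = ((MA x.1 ⊗ₖ MB x.2) * ρ).trace := by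
  have h := trace_mul_nonneg ((hA.1 x.1).kronecker (hB.1 x.2)) hρ
  exact Complex.ext rfl (Complex.nonneg_iff.1 h).2

theorem outcomeProb_nonneg (hρ : ρ.PosSemidef) (hA : IsPOVM MA) (hB : IsPOVM MB) (x : J × K) :
    0 ≤ outcomeProb ρ MA MB x :=
  (Complex.nonneg_iff.1 (trace_mul_nonneg ((hA.1 x.1).kronecker (hB.1 x.2)) hρ)).1

theorem ofReal_margA_outcomeProb (hρ : ρ.PosSemidef) (hA : IsPOVM MA) (hB : IsPOVM MB) (j : J) :
    (margA (outcomeProb ρ MA MB) j : ℂ) = (MA j * trOutB ρ).trace := by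
  rw [← trace_kronecker_one_mul, ← sum_kronecker_left (MA j) hB, Finset.sum_mul, trace_sum, margA,
    Complex.ofReal_sum]
  exact Finset.sum_congr rfl fun k _ => ofReal_outcomeProb hρ hA hB (j, k)

theorem ofReal_margB_outcomeProb (hρ : ρ.PosSemidef) (hA : IsPOVM MA) (hB : IsPOVM MB) (k : K) :
    (margB (outcomeProb ρ MA MB) k : ℂ) = (MB k * trOutA ρ).trace := by
  rw [← trace_one_kronecker_mul, ← sum_kronecker_right (MB k) hA, Finset.sum_mul, trace_sum, margB,
    Complex.ofReal_sum]
  exact Finset.sum_congr rfl fun j _ => ofReal_outcomeProb hρ hA hB (j, k)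

theorem isProb_outcomeProb (hρ : IsDensity ρ) (hA : IsPOVM MA) (hB : IsPOVM MB) :
    IsProb (outcomeProb ρ MA MB) := by
  refine ⟨outcomeProb_nonneg hρ.1 hA hB, ?_⟩
  rw [← sum_margA]
  have h : ((∑ j, margA (outcomeProb ρ MA MB) j : ℝ) : ℂ) = 1 := by
    rw [Complex.ofReal_sum]
    simp only [ofReal_margA_outcomeProb hρ.1 hA hB]
    rw [← trace_sum, ← Finset.sum_mul, hA.2, one_mul, trace_trOutB, hρ.2]
  exact_mod_cast h

theorem outcomeProb_le (hρ : ρ.PosSemidef) (hA : IsPOVM MA) (hB : IsPOVM MB) (x : J × K) :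
    outcomeProb ρ MA MB x ≤ (MB x.2).trace.re * margA (outcomeProb ρ MA MB) x.1 := by
  have h := trace_mul_nonneg
    ((hA.1 x.1).kronecker (posSemidef_trace_smul_one_sub (hB.1 x.2))) hρ
  have htr : (((MB x.2).trace.re : ℝ) : ℂ) = (MB x.2).trace :=
    Complex.ext rfl (Complex.nonneg_iff.1 (hB.1 x.2).trace_nonneg).2
  have hk : MA x.1 ⊗ₖ ((MB x.2).trace • (1 : Matrix B B ℂ) - MB x.2) =
      (MB x.2).trace • (MA x.1 ⊗ₖ (1 : Matrix B B ℂ)) - MA x.1 ⊗ₖ MB x.2 := by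
    ext a b
    simp only [kroneckerMap_apply, Matrix.sub_apply, Matrix.smul_apply, smul_eq_mul]
    ring
  rw [hk, sub_mul, trace_sub, smul_mul, trace_smul, trace_kronecker_one_mul,
    ← ofReal_margA_outcomeProb hρ hA hB, ← ofReal_outcomeProb hρ hA hB, smul_eq_mul, ← htr,
    ← Complex.ofReal_mul, sub_nonneg] at h
  exact_mod_cast h

theorem mi_outcomeProb_le (hρ : IsDensity ρ) (hA : IsPOVM MA) (hB : IsPOVM MB) :
    mi (outcomeProb ρ MA MB) ≤ (Fintype.card B - 1) / Real.log 2 := by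
  rw [le_div_iff₀' (Real.log_pos one_lt_two)]
  refine (log_two_mul_mi_le (isProb_outcomeProb hρ hA hB) (fun k => (MB k).trace.re)
    (fun k => (Complex.nonneg_iff.1 (hB.1 k).trace_nonneg).1)
    (outcomeProb_le hρ.1 hA hB)).trans_eq ?_
  rw [← Complex.re_sum, ← trace_sum, hB.2, trace_one, Complex.natCast_re]

theorem mi_outcomeProb_le_Ic (hρ : IsDensity ρ) (hA : IsPOVM MA) (hB : IsPOVM MB) :
    mi (outcomeProb ρ MA MB) ≤ Ic ρ := by
  refine le_csSup ⟨(Fintype.card B - 1) / Real.log 2, ?_⟩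
    ⟨J, K, inferInstance, inferInstance, MA, MB, hA, hB, rfl⟩
  rintro r ⟨J', K', _, _, MA', MB', hA', hB', rfl⟩
  exact mi_outcomeProb_le hρ hA' hB'

/-- The correlations visible to any local measurement are controlled by `Ic`. -/
theorem sum_norm_trace_le (hρ : IsDensity ρ) (hA : IsPOVM MA) (hB : IsPOVM MB) :
    ∑ x : J × K, ‖((MA x.1 ⊗ₖ MB x.2) * (ρ - trOutB ρ ⊗ₖ trOutA ρ)).trace‖ ≤
      √(2 * Real.log 2 * Ic ρ) := by
  have hterm : ∀ x : J × K, ‖((MA x.1 ⊗ₖ MB x.2) * (ρ - trOutB ρ ⊗ₖ trOutA ρ)).trace‖ =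
      |outcomeProb ρ MA MB x - margA (outcomeProb ρ MA MB) x.1 *
        margB (outcomeProb ρ MA MB) x.2| := by
    intro x
    rw [mul_sub, trace_sub, ← mul_kronecker_mul, trace_kronecker,
      ← ofReal_margA_outcomeProb hρ.1 hA hB, ← ofReal_margB_outcomeProb hρ.1 hA hB,
      ← ofReal_outcomeProb hρ.1 hA hB, ← Complex.ofReal_mul, ← Complex.ofReal_sub,
      Complex.norm_real, Real.norm_eq_abs]
  simp only [hterm]
  refine (sum_abs_sub_marg_le (isProb_outcomeProb hρ hA hB)).trans (Real.sqrt_le_sqrt ?_)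
  have := Real.log_pos one_lt_two
  gcongr
  exact mi_outcomeProb_le_Ic hρ hA hB

end LocalMeasurement

theorem trace_outer_mul {n : Type} [Fintype n] (φ : n → ℂ) (F : Matrix n n ℂ) :
    (outer φ * F).trace = ∑ k, ∑ l, φ k * star (φ l) * F l k := rfl

theorem trace_outer_kronecker_outer_mul {A B : Type} [Fintype A] [Fintype B] (φ : A → ℂ)
    (χ : B → ℂ) (F : Matrix (A × B) (A × B) ℂ) :
    ((outer φ ⊗ₖ outer χ) * F).trace =
      (outer φ * of fun l k => (outer χ * of fun l' k' => F (l, l') (k, k')).trace).trace := by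
  simp only [trace_outer_mul, of_apply, Finset.mul_sum]
  simp only [trace, diag_apply, mul_apply, Fintype.sum_prod_type, kroneckerMap_apply, outer,
    of_apply]
  refine Finset.sum_congr rfl fun k _ => ?_
  rw [Finset.sum_comm]
  refine Finset.sum_congr rfl fun l _ => Finset.sum_congr rfl fun k' _ =>
    Finset.sum_congr rfl fun l' _ => ?_
  ring

theorem sum_design_trace_outer_mul {n κ : Type} [Fintype n] [DecidableEq n] [Fintype κ]
    {w : κ → ℝ} {φ : κ → n → ℂ}
    (h : ∀ i j k l, ∑ x, (w x : ℂ) * (φ x i * star (φ x j) * (φ x k * star (φ x l))) =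
      (if i = j ∧ k = l then 1 else 0) + (if i = l ∧ k = j then 1 else 0))
    (F : Matrix n n ℂ) (i j : n) :
    ∑ x, (w x : ℂ) * (outer (φ x) * F).trace * (φ x i * star (φ x j)) =
      (if i = j then F.trace else 0) + F i j := by
  have h1 : ∀ x, (w x : ℂ) * (outer (φ x) * F).trace * (φ x i * star (φ x j)) =
      ∑ k, ∑ l, (w x : ℂ) * (φ x i * star (φ x j) * (φ x k * star (φ x l))) * F l k := by
    intro x
    simp only [trace_outer_mul, Finset.mul_sum, Finset.sum_mul]
    refine Finset.sum_congr rfl fun k _ => Finset.sum_congr rfl fun l _ => ?_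
    ring
  simp only [h1]
  rw [Finset.sum_comm]
  have h2 : ∀ k, ∑ x, ∑ l, (w x : ℂ) * (φ x i * star (φ x j) * (φ x k * star (φ x l))) * F l k =
      (if i = j then F k k else 0) + (if k = j then F i k else 0) := by
    intro k
    rw [Finset.sum_comm]
    simp only [← Finset.sum_mul, h, add_mul, ite_and, ite_mul, one_mul, zero_mul,
      Finset.sum_add_distrib]
    congr 1
    · split_ifs <;> simp
    · simp
  simp only [h2, Finset.sum_add_distrib]
  congr 1
  · split_ifs <;> simp [trace]
  · simp

/-- The POVM obtained by normalising a projective `2`-design. -/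
theorem isPOVM_of_design {n κ : Type} [Fintype n] [DecidableEq n] [Fintype κ]
    {w : κ → ℝ} {φ : κ → n → ℂ} (hw : ∀ x, 0 ≤ w x)
    (h : ∀ i j k l, ∑ x, (w x : ℂ) * (φ x i * star (φ x j) * (φ x k * star (φ x l))) =
      (if i = j ∧ k = l then 1 else 0) + (if i = l ∧ k = j then 1 else 0))
    (hφ : ∀ x, ∑ i, ‖φ x i‖ ^ 2 = 1) :
    IsPOVM fun x => ((w x / (Fintype.card n + 1) : ℝ) : ℂ) • outer (φ x) := by
  have hd : (Fintype.card n : ℂ) + 1 ≠ 0 := Nat.cast_add_one_ne_zero _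
  constructor
  · intro x
    refine PosSemidef.smul (posSemidef_vecMulVec_self_star (φ x)) ?_
    have := hw x
    exact Complex.zero_le_real.2 (by positivity)
  · ext i j
    have hone : ∀ x, (outer (φ x)).trace = 1 := by
      intro x
      have h1 : ((∑ i, ‖φ x i‖ ^ 2 : ℝ) : ℂ) = 1 := by rw [hφ, Complex.ofReal_one]
      rw [← h1, Complex.ofReal_sum]
      refine Finset.sum_congr rfl fun k _ => ?_
      rw [Complex.ofReal_pow]
      exact Complex.mul_conj' _
    have h1 := sum_design_trace_outer_mul h 1 i j
    simp only [mul_one, hone, trace_one, one_apply] at h1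
    simp only [Matrix.sum_apply, Matrix.smul_apply, outer, of_apply, smul_eq_mul, one_apply]
    push_cast
    simp only [div_mul_eq_mul_div]
    rw [← Finset.sum_div, h1]
    split_ifs
    · exact div_self hd
    · simp

/-- Reconstruction of an operator with vanishing marginals from a product of `2`-designs. -/
theorem sum_design_prod_trace {A B κ ι : Type} [Fintype A] [DecidableEq A] [Fintype B]
    [DecidableEq B] [Fintype κ] [Fintype ι] {w : κ → ℝ} {φ : κ → A → ℂ} {v : ι → ℝ}
    {χ : ι → B → ℂ}
    (hφ : ∀ i j k l, ∑ x, (w x : ℂ) * (φ x i * star (φ x j) * (φ x k * star (φ x l))) =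
      (if i = j ∧ k = l then 1 else 0) + (if i = l ∧ k = j then 1 else 0))
    (hχ : ∀ i j k l, ∑ x, (v x : ℂ) * (χ x i * star (χ x j) * (χ x k * star (χ x l))) =
      (if i = j ∧ k = l then 1 else 0) + (if i = l ∧ k = j then 1 else 0))
    {F : Matrix (A × B) (A × B) ℂ} (hA : trOutA F = 0) (hB : trOutB F = 0) (a b : A × B) :
    ∑ x : κ × ι, ((w x.1 : ℂ) * v x.2 * ((outer (φ x.1) ⊗ₖ outer (χ x.2)) * F).trace) *
      (φ x.1 a.1 * χ x.2 a.2 * star (φ x.1 b.1 * χ x.2 b.2)) = F a b := by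
  have inner_sum : ∀ l k, ∑ y, (v y : ℂ) *
      (outer (χ y) * of fun l' k' => F (l, l') (k, k')).trace * (χ y a.2 * star (χ y b.2)) =
        F (l, a.2) (k, b.2) := by
    intro l k
    rw [sum_design_trace_outer_mul hχ]
    have h0 : (of fun l' k' => F (l, l') (k, k')).trace = 0 := congr_fun (congr_fun hB l) k
    rw [h0, ite_self, zero_add, of_apply]
  have outer_sum : ∑ x, (w x : ℂ) *
      (outer (φ x) * of fun l k => F (l, a.2) (k, b.2)).trace * (φ x a.1 * star (φ x b.1)) =
        F a b := by
    rw [sum_design_trace_outer_mul hφ]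
    have h0 : (of fun l k => F (l, a.2) (k, b.2)).trace = 0 :=
      congr_fun (congr_fun hA a.2) b.2
    rw [h0, ite_self, zero_add, of_apply]
  rw [← outer_sum, Fintype.sum_prod_type]
  refine Finset.sum_congr rfl fun x _ => ?_
  simp only [trace_outer_kronecker_outer_mul, trace_outer_mul (φ x), of_apply, ← inner_sum]
  simp only [Finset.mul_sum, Finset.sum_mul]
  rw [Finset.sum_comm]
  refine Finset.sum_congr rfl fun k _ => ?_
  rw [Finset.sum_comm]
  refine Finset.sum_congr rfl fun l _ => Finset.sum_congr rfl fun y _ => ?_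
  rw [star_mul']
  ring

/-- The trace distance of a state to the product of its marginals is bounded by the maximal
classical mutual information of local measurements, in arbitrary finite dimensions. -/
theorem traceNorm_sub_kronecker_le {A B : Type} [Fintype A] [DecidableEq A] [Nonempty A]
    [Fintype B] [DecidableEq B] [Nonempty B] {ρ : Matrix (A × B) (A × B) ℂ} (hρ : IsDensity ρ) :
    traceNorm (ρ - trOutB ρ ⊗ₖ trOutA ρ) ≤
      ((Fintype.card A + 1) * (Fintype.card B + 1)) * √(2 * Real.log 2 * Ic ρ) := by
  obtain ⟨κ, _, w, φ, hw, hφ1, hφ⟩ := exists_projective_two_design A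
  obtain ⟨ι, _, v, χ, hv, hχ1, hχ⟩ := exists_projective_two_design B
  set F := ρ - trOutB ρ ⊗ₖ trOutA ρ
  have hmeas := sum_norm_trace_le hρ (isPOVM_of_design hw hφ hφ1) (isPOVM_of_design hv hχ hχ1)
  have hterm : ∀ x : κ × ι,
      ‖(w x.1 : ℂ) * v x.2 * ((outer (φ x.1) ⊗ₖ outer (χ x.2)) * F).trace‖ =
      ((Fintype.card A + 1) * (Fintype.card B + 1)) *
        ‖(((((w x.1 / (Fintype.card A + 1) : ℝ) : ℂ) • outer (φ x.1)) ⊗ₖ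
          (((v x.2 / (Fintype.card B + 1) : ℝ) : ℂ) • outer (χ x.2))) * F).trace‖ := by
    intro x
    have hA : (0 : ℝ) < Fintype.card A + 1 := by positivity
    have hB : (0 : ℝ) < Fintype.card B + 1 := by positivity
    rw [smul_kronecker, kronecker_smul, Matrix.smul_mul, Matrix.smul_mul, trace_smul, trace_smul, norm_smul,
      norm_smul, norm_mul, norm_mul, Complex.norm_real, Complex.norm_real, Complex.norm_real,
      Complex.norm_real, norm_div, norm_div, Real.norm_of_nonneg hA.le, Real.norm_of_nonneg hB.le]
    field_simp
  have hnorm : ∀ x : κ × ι,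
      ‖(WithLp.toLp 2 fun a => φ x.1 a.1 * χ x.2 a.2 : EuclideanSpace ℂ (A × B))‖ = 1 := by
    intro x
    rw [EuclideanSpace.norm_eq, Real.sqrt_eq_one, Fintype.sum_prod_type]
    simp only [norm_mul, mul_pow, ← Finset.mul_sum, hχ1, mul_one, hφ1]
  refine (traceNorm_le_sum_norm F _ _ hnorm fun a b => (sum_design_prod_trace hφ hχ
    (trOutA_sub_kronecker hρ) (trOutB_sub_kronecker hρ) a b).symm).trans ?_
  rw [Finset.sum_congr rfl fun x _ => hterm x, ← Finset.mul_sum]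
  exact mul_le_mul_of_nonneg_left hmeas (by positivity)

/-- Lemma 1: for a bipartite state on `ℂ^d ⊗ ℂ^d` with `d` a prime power,
`Tr|ρ_AB − ρ_A ⊗ ρ_B| ≤ (d+1)² √(2 ln 2 · I_c(ρ))`. -/
theorem stmt_11 (d : ℕ) (hd : IsPrimePow d)
    (ρ : Matrix (Fin d × Fin d) (Fin d × Fin d) ℂ) (hρ : IsDensity ρ) :
    traceNorm (ρ - trOutB ρ ⊗ₖ trOutA ρ) ≤
      ((d : ℝ) + 1) ^ 2 * Real.sqrt (2 * Real.log 2 * Ic ρ) := by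
  have hd0 : Nonempty (Fin d) := ⟨⟨0, hd.pos⟩⟩
  refine (traceNorm_sub_kronecker_le hρ).trans_eq ?_
  rw [Fintype.card_fin, pow_two]

end
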